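/- Let ℂⁿ = H_S ⊕ H_R be an orthogonal decomposition with orthogonal projections Π_S and Π_R = I − Π_S. Let H ∈ M_n(ℂ) be Hermitian and L_1, …, L_r ∈ M_n(ℂ) satisfy Π_R L_k Π_S = 0 for every k. Define B := −Π_S H Π_R − (i/2)·Σ_k Π_S L_k† L_k Π_R and the Hermitian matrix H̃ := B + B†. Then with the Hamiltonian H + H̃ and the same operators L_k, the subspace H_S is invariant for the master equation: for every density matrix ρ supported in H_S and every t ≥ 0, exp(t𝓛')(ρ) is supported in H_S, where 𝓛' is the Lindblad generator built from H + H̃ and L_1,…,L_r. -/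

import Mathlib

open scoped Matrix ComplexOrder

noncomputable section

attribute [local instance] Matrix.normedAddCommGroup Matrix.normedSpace

abbrev Mat (n : ℕ) := Matrix (Fin n) (Fin n) ℂ

/-- The Lindblad generator `𝓛(ρ) = −i[H,ρ] + Σ_k (L_k ρ L_k† − ½(L_k† L_k ρ + ρ L_k† L_k))`. -/
def lindblad {n r : ℕ} (H : Mat n) (L : Fin r → Mat n) : Mat n →ₗ[ℂ] Mat n :=
  (-Complex.I) • (LinearMap.mulLeft ℂ H - LinearMap.mulRight ℂ H)
    + ∑ k, ((LinearMap.mulRight ℂ (L k)ᴴ).comp (LinearMap.mulLeft ℂ (L k))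
        - (1/2 : ℂ) • (LinearMap.mulLeft ℂ ((L k)ᴴ * L k)
            + LinearMap.mulRight ℂ ((L k)ᴴ * L k)))

/-- `evol H L t ρ = exp (t 𝓛) ρ`, the solution of the master equation at time `t`. -/
def evol {n r : ℕ} (H : Mat n) (L : Fin r → Mat n) (t : ℝ) (ρ : Mat n) : Mat n :=
  haveI h (E : Type) [NormedAddCommGroup E] [NormedSpace ℂ E] :
    IsTopologicalRing (E →L[ℂ] E) := inferInstance
  haveI : IsTopologicalRing (Mat n →L[ℂ] Mat n) := h (Mat n)
  NormedSpace.exp ((t : ℂ) • (lindblad H L).toContinuousLinearMap) ρ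

/-- The exponential of a continuous endomorphism preserves every closed invariant submodule. -/
theorem exp_apply_mem_of_mapsTo {E : Type} [NormedAddCommGroup E] [NormedSpace ℂ E]
    [CompleteSpace E] (V : Submodule ℂ E) (hV : IsClosed (V : Set E)) (A : E →L[ℂ] E)
    (hA : ∀ x ∈ V, A x ∈ V) {x : E} (hx : x ∈ V) : NormedSpace.exp A x ∈ V := by
  have hpow : ∀ k : ℕ, (A ^ k) x ∈ V := by
    intro k
    induction k with
    | zero => simpa using hx
    | succ k ih =>
      rw [pow_succ']
      exact hA _ ih
  have hsum := (NormedSpace.exp_series_hasSum_exp' (𝕂 := ℂ) A).mapL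
    (ContinuousLinearMap.apply ℂ E x)
  refine hV.mem_of_tendsto hsum (Filter.Eventually.of_forall fun s => ?_)
  exact V.sum_mem fun k _ => V.smul_mem _ (hpow k)

theorem lindblad_apply {n r : ℕ} (H : Mat n) (L : Fin r → Mat n) (X : Mat n) :
    lindblad H L X = (-Complex.I) • (H * X - X * H) + ∑ k, L k * X * (L k)ᴴ
      - (1/2 : ℂ) • ((∑ k, (L k)ᴴ * L k) * X + X * ∑ k, (L k)ᴴ * L k) := by
  simp only [lindblad, LinearMap.add_apply, LinearMap.smul_apply, LinearMap.sub_apply,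
    LinearMap.sum_apply, LinearMap.comp_apply, LinearMap.mulLeft_apply, LinearMap.mulRight_apply,
    Finset.sum_sub_distrib, ← Finset.smul_sum, Finset.sum_add_distrib, Finset.sum_mul,
    Finset.mul_sum]
  abel

/-- The matrices `X` with `P * X * P = X`. -/
def supportedSubmodule {n : ℕ} (P : Mat n) : Submodule ℂ (Mat n) :=
  LinearMap.eqLocus ((LinearMap.mulRight ℂ P).comp (LinearMap.mulLeft ℂ P)) LinearMap.id

theorem mem_supportedSubmodule {n : ℕ} {P X : Mat n} :
    X ∈ supportedSubmodule P ↔ P * X * P = X := Iff.rfl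

/-- If `Π_R L_k Π_S = 0` and the off-diagonal blocks of `G` compensate those of `Σ_k L_k† L_k`,
then the Lindblad generator preserves the matrices supported in the range of `P`. -/
theorem lindblad_mem_supportedSubmodule {n r : ℕ} {P : Mat n} (hPH : P.IsHermitian)
    (hP : P * P = P) {G : Mat n} {L : Fin r → Mat n} (hL : ∀ k, (1 - P) * L k * P = 0)
    (hRS : (1 - P) * G * P = (Complex.I / 2) • ((1 - P) * (∑ k, (L k)ᴴ * L k) * P))
    (hSR : P * G * (1 - P) = -(Complex.I / 2) • (P * (∑ k, (L k)ᴴ * L k) * (1 - P)))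
    {X : Mat n} (hX : X ∈ supportedSubmodule P) : lindblad G L X ∈ supportedSubmodule P := by
  rw [mem_supportedSubmodule] at hX ⊢
  have hPX : P * X = X := by
    rw [← hX, mul_assoc P X P, ← mul_assoc P P, hP]
  have hXP : X * P = X := by
    rw [← hX, mul_assoc (P * X) P P, hP]
  have hQX : (1 - P) * X = 0 := by rw [sub_mul, one_mul, hPX, sub_self]
  have hXQ : X * (1 - P) = 0 := by rw [mul_sub, mul_one, hXP, sub_self]
  have hL' : ∀ k, P * (L k)ᴴ * (1 - P) = 0 := by
    intro k
    have h := congrArg Matrix.conjTranspose (hL k)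
    simpa [Matrix.conjTranspose_mul, hPH.eq, mul_assoc] using h
  have hI : Complex.I * (Complex.I / 2) = -(1 / 2) := by
    rw [← mul_div_assoc, Complex.I_mul_I]; ring
  have left (M : Mat n) : (1 - P) * (M * X) = (1 - P) * M * P * X := by
    rw [mul_assoc _ P X, hPX, mul_assoc]
  have right (M : Mat n) : X * M * (1 - P) = X * (P * M * (1 - P)) := by
    rw [← mul_assoc, ← mul_assoc, hXP]
  have hleft : (1 - P) * lindblad G L X = 0 := by
    have hjump : (1 - P) * ∑ k, L k * X * (L k)ᴴ = 0 := by
      rw [Finset.mul_sum]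
      refine Finset.sum_eq_zero fun k _ => ?_
      rw [← mul_assoc, left, hL, zero_mul, zero_mul]
    rw [lindblad_apply, mul_sub, mul_add, hjump, mul_smul_comm, mul_smul_comm, mul_sub, mul_add,
      left, left, ← mul_assoc _ X, ← mul_assoc _ X, hQX, zero_mul, zero_mul, hRS, smul_mul_assoc,
      sub_zero, add_zero, add_zero, smul_smul, ← sub_smul, neg_mul, hI]
    simp
  have hright : lindblad G L X * (1 - P) = 0 := by
    have hjump : (∑ k, L k * X * (L k)ᴴ) * (1 - P) = 0 := by
      rw [Finset.sum_mul]
      refine Finset.sum_eq_zero fun k _ => ?_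
      rw [mul_assoc (L k), mul_assoc (L k), right, hL', mul_zero, mul_zero]
    rw [lindblad_apply, sub_mul, add_mul, hjump, smul_mul_assoc, smul_mul_assoc, sub_mul, add_mul,
      right, right, mul_assoc _ X, mul_assoc _ X, hXQ, mul_zero, mul_zero, hSR, mul_smul_comm,
      zero_sub, add_zero, zero_add, smul_neg, smul_smul, ← neg_smul, ← sub_smul, neg_mul_neg, hI]
    simp
  rw [sub_mul, one_mul, sub_eq_zero] at hleft
  rw [mul_sub, mul_one, sub_eq_zero] at hright
  rw [← hleft, ← hright]

/-- If `Π_R L_k Π_S = 0` for all `k`, then with the corrected Hamiltonian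
`H + H̃`, where `H̃ = B + B†` and `B = −Π_S H Π_R − (i/2) Σ_k Π_S L_k† L_k Π_R`,
the subspace `H_S` is invariant for the master equation. -/
theorem invariance_by_hamiltonian_correction {n r : ℕ}
    (PS : Mat n) (hPH : PS.IsHermitian) (hPidem : PS * PS = PS)
    (H : Mat n) (hH : H.IsHermitian) (L : Fin r → Mat n)
    (hLQ : ∀ k, (1 - PS) * L k * PS = 0)
    (B : Mat n)
    (hB : B = -(PS * H * (1 - PS)) - (Complex.I / 2) • ∑ k, PS * ((L k)ᴴ * L k) * (1 - PS)) :
    ∀ ρ : Mat n, ρ.PosSemidef → ρ.trace = 1 → PS * ρ * PS = ρ →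
      ∀ t : ℝ, 0 ≤ t →
        PS * evol (H + (B + Bᴴ)) L t ρ * PS = evol (H + (B + Bᴴ)) L t ρ := by
  intro ρ _ _ hρ t _
  have hPH' : PSᴴ = PS := hPH
  have hHH' : Hᴴ = H := hH
  have hQ : (1 - PS) * (1 - PS) = 1 - PS := by
    rw [sub_mul, one_mul, mul_sub, mul_one, hPidem, sub_self, sub_zero]
  have hPQ : PS * (1 - PS) = 0 := by rw [mul_sub, mul_one, hPidem, sub_self]
  have hQP : (1 - PS) * PS = 0 := by rw [sub_mul, one_mul, hPidem, sub_self]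
  set K : Mat n := ∑ k, (L k)ᴴ * L k with hK
  have hKH : Kᴴ = K := by
    simp [hK, Matrix.conjTranspose_sum, Matrix.conjTranspose_mul]
  have hBK : B = -(PS * H * (1 - PS)) - (Complex.I / 2) • (PS * K * (1 - PS)) := by
    rw [hB, hK, Finset.mul_sum, Finset.sum_mul]
  have hBH : Bᴴ = -((1 - PS) * H * PS) + (Complex.I / 2) • ((1 - PS) * K * PS) := by
    rw [hBK]
    simp only [Matrix.conjTranspose_sub, Matrix.conjTranspose_neg, Matrix.conjTranspose_smul,
      Matrix.conjTranspose_mul, Matrix.conjTranspose_one, hPH', hHH', hKH, mul_assoc]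
    simp [neg_div, sub_eq_add_neg]
  have compress (S T U V M : Mat n) : S * (U * M * V) * T = (S * U) * M * (V * T) := by
    simp only [mul_assoc]
  have hRS : (1 - PS) * (H + (B + Bᴴ)) * PS = (Complex.I / 2) • ((1 - PS) * K * PS) := by
    rw [hBH, hBK]
    generalize 1 - PS = Q at hQ hPQ hQP ⊢
    simp only [mul_add, add_mul, mul_sub, sub_mul, mul_neg, neg_mul,
      mul_smul_comm, smul_mul_assoc, compress, hQ, hQP, hPidem, zero_mul, smul_zero, neg_zero,
      sub_zero]
    abel
  have hSR : PS * (H + (B + Bᴴ)) * (1 - PS) = -(Complex.I / 2) • (PS * K * (1 - PS)) := by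
    rw [hBH, hBK]
    generalize 1 - PS = Q at hQ hPQ hQP ⊢
    simp only [mul_add, add_mul, mul_sub, sub_mul, mul_neg, neg_mul,
      mul_smul_comm, smul_mul_assoc, compress, hQ, hPQ, hPidem, zero_mul, smul_zero, neg_zero,
      add_zero, neg_smul]
    abel
  refine mem_supportedSubmodule.1 (exp_apply_mem_of_mapsTo (supportedSubmodule PS)
    (Submodule.closed_of_finiteDimensional _) _ (fun X hX => ?_) hρ)
  exact Submodule.smul_mem _ _ (lindblad_mem_supportedSubmodule hPH hPidem hLQ hRS hSR hX)
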